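/- Let (X_t) be a Lévy process and suppose (i) P(X_{t+1} > 0)/P(X_t > 0) → e^{-γ} as t → ∞ and (ii) P(X_t > 0)/P(X_t > y) → e^{α y} for every fixed y, with convergence uniform on compacts. Then E[e^{α X_1}] = e^{-γ}. -/

import Mathlib

open MeasureTheory ProbabilityTheory Filter Set Real

/-- Decomposition of the tail of a sum of independent variables over the second summand. -/
theorem ProbabilityTheory.IndepFun.measure_pos_add {Ω : Type*} [MeasurableSpace Ω] {μ : Measure Ω}
    [IsProbabilityMeasure μ] {Y D : Ω → ℝ} (hY : Measurable Y) (hD : Measurable D)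
    (h : IndepFun Y D μ) :
    μ {ω | 0 < Y ω + D ω} = ∫⁻ y, μ {ω | -y < Y ω} ∂(μ.map D) := by
  have := Measure.isProbabilityMeasure_map (μ := μ) hY.aemeasurable
  have := Measure.isProbabilityMeasure_map (μ := μ) hD.aemeasurable
  have hS : MeasurableSet {p : ℝ × ℝ | 0 < p.1 + p.2} :=
    measurableSet_lt measurable_const (measurable_fst.add measurable_snd)
  have h1 : μ {ω | 0 < Y ω + D ω}
      = (μ.map fun ω => (Y ω, D ω)) {p : ℝ × ℝ | 0 < p.1 + p.2} := by
    rw [Measure.map_apply (hY.prodMk hD) hS]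
    rfl
  rw [h1, (indepFun_iff_map_prod_eq_prod_map_map hY.aemeasurable hD.aemeasurable).1 h,
    Measure.prod_apply_symm hS]
  refine lintegral_congr fun y => ?_
  rw [Measure.map_apply hY (measurable_prodMk_right hS)]
  congr 1
  ext ω
  simp [neg_lt_iff_pos_add]

/-- A tail probability of a real random variable is monotone, hence measurable, in the level. -/
theorem measurable_measure_neg_lt {Ω : Type*} [MeasurableSpace Ω] (μ : Measure Ω) (Y : Ω → ℝ) :
    Measurable fun y : ℝ => μ {ω | -y < Y ω} :=
  Monotone.measurable fun _ _ hab =>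
    measure_mono fun _ hω => lt_of_le_of_lt (neg_le_neg hab) hω

/-- The Laplace transform of the `n`-th value of a process with stationary independent
increments is the `n`-th power of that of the first value. -/
theorem lintegral_exp_mul_eq_pow {Ω : Type*} [MeasurableSpace Ω] {μ : Measure Ω}
    {X : ℝ → Ω → ℝ} (hmeas : ∀ t, Measurable (X t)) (α : ℝ)
    (hind : ∀ t : ℝ, 0 ≤ t → IndepFun (X t) (fun ω => X (t + 1) ω - X t ω) μ)
    (hstat : ∀ t : ℝ, 0 ≤ t → μ.map (fun ω => X (t + 1) ω - X t ω) = μ.map (X 1)) (n : ℕ) :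
    ∫⁻ ω, ENNReal.ofReal (exp (α * X ((n : ℝ) + 1) ω)) ∂μ
      = (∫⁻ ω, ENNReal.ofReal (exp (α * X 1 ω)) ∂μ) ^ (n + 1) := by
  have hE : Measurable fun x : ℝ => ENNReal.ofReal (exp (α * x)) := by fun_prop
  induction n with
  | zero => simp
  | succ n ih =>
    have h0 : (0 : ℝ) ≤ (n : ℝ) + 1 := by positivity
    have hD : Measurable fun ω => X ((n : ℝ) + 1 + 1) ω - X ((n : ℝ) + 1) ω :=
      (hmeas _).sub (hmeas _)
    have hI : ∫⁻ ω, ENNReal.ofReal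
          (exp (α * (X ((n : ℝ) + 1 + 1) ω - X ((n : ℝ) + 1) ω))) ∂μ
        = ∫⁻ ω, ENNReal.ofReal (exp (α * X 1 ω)) ∂μ := by
      rw [← lintegral_map hE hD, hstat _ h0, lintegral_map hE (hmeas 1)]
    have hprod := lintegral_mul_eq_lintegral_mul_lintegral_of_indepFun
      (hE.comp (hmeas _)) (hE.comp hD) ((hind _ h0).comp hE hE)
    simp only [Function.comp_def, Pi.mul_apply] at hprod
    rw [pow_succ, ← ih, ← hI, ← hprod]
    refine lintegral_congr fun ω => ?_
    rw [← ENNReal.ofReal_mul (exp_pos _).le, ← exp_add]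
    push_cast
    congr 2
    ring

/-- Chernoff bound at level `0`. -/
theorem measure_pos_le_lintegral_exp_mul {Ω : Type*} [MeasurableSpace Ω] (μ : Measure Ω)
    {Y : Ω → ℝ} (hY : Measurable Y) {α : ℝ} (hα : 0 ≤ α) :
    μ {ω | 0 < Y ω} ≤ ∫⁻ ω, ENNReal.ofReal (exp (α * Y ω)) ∂μ := by
  rw [← lintegral_indicator_one (measurableSet_lt measurable_const hY)]
  refine lintegral_mono (indicator_le' (fun ω hω => ?_) fun _ _ => zero_le)
  rw [Pi.one_apply, ENNReal.one_le_ofReal, one_le_exp_iff]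
  exact mul_nonneg hα (le_of_lt hω)

/-- A positive sequence dominated by `C * b ^ n` has ratio limit at most `b`. -/
theorem le_of_tendsto_ratio_of_le_pow {p : ℕ → ℝ} {b c C : ℝ} (hp : ∀ n, 0 < p n) (hb : 0 ≤ b)
    (hle : ∀ n, p n ≤ C * b ^ n)
    (hlim : Tendsto (fun n => p (n + 1) / p n) atTop (nhds c)) : c ≤ b := by
  by_contra! hbc
  obtain ⟨r, hbr, hrc⟩ := exists_between hbc
  have hr : 0 < r := hb.trans_lt hbr
  obtain ⟨N, hN⟩ := eventually_atTop.1 (hlim.eventually (lt_mem_nhds hrc))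
  have hgrow : ∀ k, p N * r ^ k ≤ p (N + k) := by
    intro k
    induction k with
    | zero => simp
    | succ k ih =>
      have h1 := (lt_div_iff₀ (hp (N + k))).1 (hN (N + k) (Nat.le_add_right _ _))
      calc p N * r ^ (k + 1) = r * (p N * r ^ k) := by ring
        _ ≤ r * p (N + k) := by gcongr
        _ ≤ p (N + (k + 1)) := h1.le
  have hq : Tendsto (fun k : ℕ => C * b ^ N * (b / r) ^ k) atTop (nhds 0) := by
    simpa using (tendsto_pow_atTop_nhds_zero_of_lt_one (div_nonneg hb hr.le)
      ((div_lt_one hr).2 hbr)).const_mul (C * b ^ N)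
  refine (hp N).not_ge (ge_of_tendsto' hq fun k => ?_)
  rw [div_pow, ← mul_div_assoc, le_div_iff₀ (pow_pos hr k)]
  calc p N * r ^ k ≤ p (N + k) := hgrow k
    _ ≤ C * b ^ (N + k) := hle _
    _ = C * b ^ N * b ^ k := by ring

/-- For a Lévy process (stationary independent increments), if
`P(X_{t+1} > 0)/P(X_t > 0) → e^{-γ}` and `P(X_t > 0)/P(X_t > y) → e^{αy}` for every
fixed `y`, uniformly on compacts, then `E e^{α X_1} = e^{-γ}`. -/
theorem stmt16 {Ω : Type*} [MeasurableSpace Ω] (μ : Measure Ω) [IsProbabilityMeasure μ]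
    (X : ℝ → Ω → ℝ) (hmeas : ∀ t, Measurable (X t))
    (α γ : ℝ) (hα : 0 ≤ α) (hγ : 0 ≤ γ)
    (hind : ∀ t : ℝ, 0 ≤ t → IndepFun (X t) (fun ω => X (t + 1) ω - X t ω) μ)
    (hstat : ∀ t : ℝ, 0 ≤ t → μ.map (fun ω => X (t + 1) ω - X t ω) = μ.map (X 1))
    (hpos : ∀ t : ℝ, 0 < t → 0 < (μ {ω | 0 < X t ω}).toReal)
    (hi : Tendsto
      (fun t : ℝ => (μ {ω | 0 < X (t + 1) ω}).toReal / (μ {ω | 0 < X t ω}).toReal)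
      atTop (nhds (Real.exp (-γ))))
    (hii : ∀ K > (0 : ℝ), ∀ δ > (0 : ℝ), ∃ T : ℝ, ∀ t ≥ T, ∀ y : ℝ, |y| ≤ K →
      |(μ {ω | 0 < X t ω}).toReal / (μ {ω | y < X t ω}).toReal - Real.exp (α * y)| ≤ δ) :
    ∫ ω, Real.exp (α * X 1 ω) ∂μ = Real.exp (-γ) := by
  have hcast : Tendsto (fun n : ℕ => (n : ℝ) + 1) atTop atTop :=
    tendsto_atTop_add_const_right _ _ tendsto_natCast_atTop_atTop
  have hn0 : ∀ n : ℕ, (0 : ℝ) < (n : ℝ) + 1 := fun n => by positivity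
  have hratio := hi.comp hcast
  have hE : Measurable fun x : ℝ => ENNReal.ofReal (exp (α * x)) := by fun_prop
  have hp0 : ∀ n : ℕ, μ {ω | 0 < X ((n : ℝ) + 1) ω} ≠ 0 := fun n h => by
    simpa [h] using hpos _ (hn0 n)
  have htail : ∀ y : ℝ, Tendsto (fun n : ℕ =>
      μ {ω | -y < X ((n : ℝ) + 1) ω} * (μ {ω | 0 < X ((n : ℝ) + 1) ω})⁻¹) atTop
      (nhds (ENNReal.ofReal (exp (α * y)))) := by
    intro y
    have h1 : Tendsto (fun t : ℝ =>
        (μ {ω | 0 < X t ω}).toReal / (μ {ω | -y < X t ω}).toReal) atTop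
        (nhds (exp (α * -y))) := by
      rw [Metric.tendsto_atTop]
      intro ε hε
      obtain ⟨T, hT⟩ := hii (|y| + 1) (by positivity) (ε / 2) (half_pos hε)
      refine ⟨T, fun t ht => ?_⟩
      rw [Real.dist_eq]
      exact (hT t ht (-y) (by rw [abs_neg]; linarith)).trans_lt (half_lt_self hε)
    have h2 := (h1.inv₀ (exp_pos _).ne').comp hcast
    rw [← exp_neg, mul_neg, neg_neg] at h2
    refine (ENNReal.tendsto_ofReal h2).congr fun n => ?_
    rw [Function.comp_apply, inv_div, ← ENNReal.toReal_div, ← div_eq_mul_inv,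
      ENNReal.ofReal_toReal (ENNReal.div_ne_top (measure_ne_top _ _) (hp0 n))]
  have hdecomp : ∀ n : ℕ, ∫⁻ y, μ {ω | -y < X ((n : ℝ) + 1) ω}
        * (μ {ω | 0 < X ((n : ℝ) + 1) ω})⁻¹ ∂(μ.map (X 1))
      = ENNReal.ofReal ((μ {ω | 0 < X ((n : ℝ) + 1 + 1) ω}).toReal
          / (μ {ω | 0 < X ((n : ℝ) + 1) ω}).toReal) := by
    intro n
    rw [lintegral_mul_const _ (measurable_measure_neg_lt μ _), ← hstat _ (hn0 n).le,
      ← IndepFun.measure_pos_add (hmeas _)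
        (Measurable.fun_sub (hmeas _) (hmeas _)) (hind _ (hn0 n).le),
      ← ENNReal.toReal_div, ENNReal.ofReal_toReal
        (ENNReal.div_ne_top (measure_ne_top _ _) (hp0 n)), div_eq_mul_inv]
    simp
  have hle : ∫⁻ ω, ENNReal.ofReal (exp (α * X 1 ω)) ∂μ ≤ ENNReal.ofReal (exp (-γ)) := by
    rw [← lintegral_map hE (hmeas 1)]
    calc ∫⁻ y, ENNReal.ofReal (exp (α * y)) ∂(μ.map (X 1))
        = ∫⁻ y, liminf (fun n : ℕ => μ {ω | -y < X ((n : ℝ) + 1) ω}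
            * (μ {ω | 0 < X ((n : ℝ) + 1) ω})⁻¹) atTop ∂(μ.map (X 1)) :=
          lintegral_congr fun y => (htail y).liminf_eq.symm
      _ ≤ liminf (fun n : ℕ => ∫⁻ y, μ {ω | -y < X ((n : ℝ) + 1) ω}
            * (μ {ω | 0 < X ((n : ℝ) + 1) ω})⁻¹ ∂(μ.map (X 1))) atTop :=
          lintegral_liminf_le fun n => (measurable_measure_neg_lt μ _).mul_const _
      _ = ENNReal.ofReal (exp (-γ)) := by
          simp_rw [hdecomp]
          exact (ENNReal.tendsto_ofReal hratio).liminf_eq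
  have hfin : ∫⁻ ω, ENNReal.ofReal (exp (α * X 1 ω)) ∂μ ≠ ⊤ :=
    ne_top_of_le_ne_top ENNReal.ofReal_ne_top hle
  rw [integral_eq_lintegral_of_nonneg_ae (Eventually.of_forall fun ω => (exp_pos _).le)
    (by have := hmeas 1; fun_prop)]
  refine le_antisymm (ENNReal.toReal_le_of_le_ofReal (exp_pos _).le hle) ?_
  refine le_of_tendsto_ratio_of_le_pow
    (p := fun n : ℕ => (μ {ω | 0 < X ((n : ℝ) + 1) ω}).toReal)
    (C := (∫⁻ ω, ENNReal.ofReal (exp (α * X 1 ω)) ∂μ).toReal)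
    (fun n => hpos _ (hn0 n)) ENNReal.toReal_nonneg (fun n => ?_) ?_
  · rw [← pow_succ', ← ENNReal.toReal_pow]
    refine ENNReal.toReal_mono (ENNReal.pow_ne_top hfin) ?_
    rw [← lintegral_exp_mul_eq_pow hmeas α hind hstat n]
    exact measure_pos_le_lintegral_exp_mul μ (hmeas _) hα
  · refine hratio.congr fun n => ?_
    simp
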